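/- Let (Ω, 𝓕, μ) be a probability space and (ε_a, ε_b) : Ω → ℝ × ℝ a random vector whose joint law has a density f with respect to two-dimensional Lebesgue measure satisfying f > 0 everywhere on ℝ². For d ∈ {0,1}, let (a_d, b_d) ∈ ℝ². Then the following two conditions hold jointly: (i) μ({b₁ + ε_b < a₁ + ε_a}) = μ({b₀ + ε_b < a₀ + ε_a}), and (ii) for every y ∈ ℝ, μ({b₁ + ε_b < a₁ + ε_a ≤ y}) = μ({b₀ + ε_b < a₀ + ε_a ≤ y}), if and only if a₁ = a₀ and b₁ = b₀. -/

import Mathlib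

open MeasureTheory

/-- A measure with an everywhere positive density charges nonempty open sets. -/
theorem isOpenPosMeasure_withDensity_of_pos {α : Type*} [TopologicalSpace α] [MeasurableSpace α]
    (ν : Measure α) [ν.IsOpenPosMeasure] {f : α → ENNReal} (hf : Measurable f)
    (hfpos : ∀ p, 0 < f p) : (ν.withDensity f).IsOpenPosMeasure :=
  (withDensity_absolutelyContinuous' hf.aemeasurable
    (Filter.Eventually.of_forall fun p => (hfpos p).ne')).isOpenPosMeasure

/-- If the law of `X` charges nonempty open sets, then the gap between two nested events of equal
probability contains no preimage of a nonempty open set. -/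
theorem eq_empty_of_preimage_subset_diff {Ω α : Type*} [MeasurableSpace Ω] {μ : Measure Ω}
    [IsFiniteMeasure μ] [TopologicalSpace α] [MeasurableSpace α] [OpensMeasurableSpace α]
    {X : Ω → α} (hX : Measurable X) [(Measure.map X μ).IsOpenPosMeasure] {A B : Set Ω}
    (hA : MeasurableSet A) (hAB : A ⊆ B) (h : μ A = μ B) {U : Set α} (hU : IsOpen U)
    (hsub : X ⁻¹' U ⊆ B \ A) : U = ∅ := by
  have hdiff : μ (B \ A) = 0 := by
    rw [measure_sdiff hAB hA.nullMeasurableSet (measure_ne_top μ A), h, tsub_self]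
  refine (hU.measure_eq_zero_iff (Measure.map X μ)).1 ?_
  rw [Measure.map_apply hX hU.measurableSet]
  exact measure_mono_null hsub hdiff

section Roy

variable {Ω : Type*} [MeasurableSpace Ω] {μ : Measure Ω} [IsFiniteMeasure μ] {εa εb : Ω → ℝ}
  {a₁ a₀ b₁ b₀ : ℝ}

/-- Equal choice probabilities force the index differences to be ordered. -/
theorem index_sub_le_of_choice_prob_eq (hεa : Measurable εa) (hεb : Measurable εb)
    [(Measure.map (fun ω => (εa ω, εb ω)) μ).IsOpenPosMeasure]
    (h : μ {ω | b₁ + εb ω < a₁ + εa ω} = μ {ω | b₀ + εb ω < a₀ + εa ω}) :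
    b₁ - a₁ ≤ b₀ - a₀ := by
  by_contra! hlt
  have hU : IsOpen {p : ℝ × ℝ | b₀ - a₀ < p.1 - p.2 ∧ p.1 - p.2 < b₁ - a₁} :=
    .and (isOpen_lt (by fun_prop) (by fun_prop)) (isOpen_lt (by fun_prop) (by fun_prop))
  have hempty := eq_empty_of_preimage_subset_diff (hεa.prodMk hεb)
    (measurableSet_lt (hεb.const_add b₁) (hεa.const_add a₁))
    (fun ω hω => by simp only [Set.mem_ofPred_eq] at hω ⊢; linarith) h hU
    (fun ω hω => by
      simp only [Set.mem_preimage, Set.mem_ofPred_eq] at hω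
      simp only [Set.mem_sdiff, Set.mem_ofPred_eq, not_lt]
      constructor <;> linarith)
  obtain ⟨t, ht₀, ht₁⟩ := exists_between hlt
  have hmem : (t, (0 : ℝ)) ∈ {p : ℝ × ℝ | b₀ - a₀ < p.1 - p.2 ∧ p.1 - p.2 < b₁ - a₁} := by
    simpa using ⟨ht₀, ht₁⟩
  simp [hempty] at hmem

/-- Given equal index differences, equal joint probabilities of choice and outcome level force the
indices to be ordered. -/
theorem index_le_of_joint_prob_eq (hεa : Measurable εa) (hεb : Measurable εb)
    [(Measure.map (fun ω => (εa ω, εb ω)) μ).IsOpenPosMeasure] (hab : b₁ - a₁ = b₀ - a₀) {y : ℝ}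
    (h : μ {ω | b₁ + εb ω < a₁ + εa ω ∧ a₁ + εa ω ≤ y}
      = μ {ω | b₀ + εb ω < a₀ + εa ω ∧ a₀ + εa ω ≤ y}) :
    a₁ ≤ a₀ := by
  by_contra! hlt
  have hU : IsOpen {p : ℝ × ℝ | b₀ - a₀ < p.1 - p.2 ∧ y - a₁ < p.1 ∧ p.1 < y - a₀} :=
    .and (isOpen_lt (by fun_prop) (by fun_prop))
      (.and (isOpen_lt (by fun_prop) (by fun_prop)) (isOpen_lt (by fun_prop) (by fun_prop)))
  have hempty := eq_empty_of_preimage_subset_diff (hεa.prodMk hεb)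
    ((measurableSet_lt (hεb.const_add b₁) (hεa.const_add a₁)).inter
      (measurableSet_le (hεa.const_add a₁) measurable_const))
    (fun ω hω => by
      obtain ⟨hω₁, hω₂⟩ := hω
      simp only [Set.mem_ofPred_eq] at hω₁ hω₂ ⊢
      constructor <;> linarith) h hU
    (fun ω hω => by
      obtain ⟨hω₁, hω₂, hω₃⟩ := hω
      refine ⟨⟨by linarith, by linarith⟩, fun hω' => ?_⟩
      have := hω'.2
      simp only [Set.mem_ofPred_eq] at this
      linarith)
  obtain ⟨t, ht₁, ht₀⟩ := exists_between (sub_lt_sub_left hlt y)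
  have hmem : (t, t - (b₀ - a₀) - 1) ∈
      {p : ℝ × ℝ | b₀ - a₀ < p.1 - p.2 ∧ y - a₁ < p.1 ∧ p.1 < y - a₀} :=
    ⟨by simp only; linarith, ht₁, ht₀⟩
  simp [hempty] at hmem

end Roy

/-- Example 3 (Roy model): with `(ε_a, ε_b)` having an everywhere-positive joint density,
matching the sector-choice probabilities together with the joint probabilities of sector
choice and outcome level is equivalent to matching both indices. -/
theorem roy_model_matching_iff
    {Ω : Type*} [MeasurableSpace Ω] (μ : Measure Ω) [IsProbabilityMeasure μ]
    (εa εb : Ω → ℝ) (hεa : Measurable εa) (hεb : Measurable εb)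
    (f : ℝ × ℝ → ENNReal) (hf : Measurable f) (hfpos : ∀ p : ℝ × ℝ, 0 < f p)
    (hdens : Measure.map (fun ω => (εa ω, εb ω)) μ = volume.withDensity f)
    (a₁ a₀ b₁ b₀ : ℝ) :
    (μ {ω | b₁ + εb ω < a₁ + εa ω} = μ {ω | b₀ + εb ω < a₀ + εa ω}
      ∧ ∀ y : ℝ,
          μ {ω | b₁ + εb ω < a₁ + εa ω ∧ a₁ + εa ω ≤ y}
            = μ {ω | b₀ + εb ω < a₀ + εa ω ∧ a₀ + εa ω ≤ y})
      ↔ (a₁ = a₀ ∧ b₁ = b₀) := by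
  constructor
  · rintro ⟨hchoice, hjoint⟩
    have : (Measure.map (fun ω => (εa ω, εb ω)) μ).IsOpenPosMeasure :=
      hdens ▸ isOpenPosMeasure_withDensity_of_pos volume hf hfpos
    have hab : b₁ - a₁ = b₀ - a₀ :=
      le_antisymm (index_sub_le_of_choice_prob_eq hεa hεb hchoice)
        (index_sub_le_of_choice_prob_eq hεa hεb hchoice.symm)
    have ha : a₁ = a₀ :=
      le_antisymm (index_le_of_joint_prob_eq hεa hεb hab (hjoint 0))
        (index_le_of_joint_prob_eq hεa hεb hab.symm (hjoint 0).symm)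
    exact ⟨ha, by linarith⟩
  · rintro ⟨rfl, rfl⟩
    exact ⟨rfl, fun _ => rfl⟩
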